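/- arXiv:2507.15667 — 5 statements merged into one kernel-verified Lean document; each statement's English description precedes it below -/
import Mathlib

section
/- Let D=(V,A) be a 2-strong semicomplete multipartite digraph and let x, y, z ∈ V be such that D−z contains an (x,y)-quasi-Hamiltonian path P = v_0 v_1 … v_{ℓ+1} (so v_0 = x and v_{ℓ+1} = y). If at least one of the following conditions holds, then D contains an (x,y)-quasi-Hamiltonian path: (a) |H(z)| > 1; (b) there exist indices i and j with 0 ≤ i < j ≤ ℓ+1 such that both arcs v_i z and z v_j are in A; (c) the arc xz is in A or the arc zy is in A. -/
open Set

variable {V : Type*}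

/-- `p` is a directed path (nonempty, vertices pairwise distinct, consecutive
vertices joined by arcs of `A`) all of whose vertices lie in `S`. -/
def IsPathOn (A : V → V → Prop) (S : Set V) (p : List V) : Prop :=
  p ≠ [] ∧ p.Nodup ∧ p.Chain' A ∧ ∀ v ∈ p, v ∈ S

/-- `p` is a directed path within `S` starting at `x` and ending at `y`. -/
def IsPathFromTo (A : V → V → Prop) (S : Set V) (p : List V) (x y : V) : Prop :=
  IsPathOn A S p ∧ p.head? = some x ∧ p.getLast? = some y

/-- The subdigraph induced on `S` is strong. -/
def StrongOn (A : V → V → Prop) (S : Set V) : Prop :=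
  ∀ x ∈ S, ∀ y ∈ S, x ≠ y → ∃ p, IsPathFromTo A S p x y

/-- The subdigraph induced on `S` is `k`-strong: it has at least `k+1` vertices and
remains strong after deleting any set of at most `k-1` vertices. -/
def KStrongOn (A : V → V → Prop) (k : ℕ) (S : Set V) : Prop :=
  k + 1 ≤ S.ncard ∧ ∀ X : Set V, X ⊆ S → X.ncard ≤ k - 1 → StrongOn A (S \ X)

/-- In a semicomplete multipartite digraph, two vertices lie in the same color class
iff they are equal or there is no arc between them in either direction. -/
def SameClass (A : V → V → Prop) (u v : V) : Prop :=
  u = v ∨ (¬ A u v ∧ ¬ A v u)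

/-- `A` is (the arc relation of) a semicomplete multipartite digraph: it is loopless
and the "same color class" relation is transitive (hence an equivalence relation whose
classes are the color classes: within a class there are no arcs, and between any two
vertices of different classes there is at least one arc). -/
def IsSMD (A : V → V → Prop) : Prop :=
  (∀ v, ¬ A v v) ∧
  ∀ u v w, SameClass A u v → SameClass A v w → SameClass A u w

/-- A digraph is unilaterally connected if any two distinct vertices are joined by a
directed path in one direction or the other. -/
def Unilateral (A : V → V → Prop) : Prop :=
  ∀ x y : V, x ≠ y →
    (∃ p, IsPathFromTo A Set.univ p x y) ∨ (∃ p, IsPathFromTo A Set.univ p y x)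

/-- The independence number of a semicomplete multipartite digraph: the maximum size
of a color class. -/
noncomputable def indepNum [Fintype V] (A : V → V → Prop) : ℕ :=
  Finset.univ.sup fun v : V => {u | SameClass A v u}.ncard

/-- `X` is a 2-separator of `x` and `y`: at most two vertices, avoiding `x` and `y`,
whose removal destroys all `(x,y)`-paths. -/
def IsTwoSep (A : V → V → Prop) (x y : V) (X : Set V) : Prop :=
  X ⊆ ({x, y} : Set V)ᶜ ∧ X.ncard ≤ 2 ∧ ¬ ∃ p, IsPathFromTo A Xᶜ p x y

/-- A separator of `x` and `y` is trivial if it contains all out-neighbors of `x`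
or all in-neighbors of `y`. -/
def IsTrivialSep (A : V → V → Prop) (x y : V) (X : Set V) : Prop :=
  {w | A x w} ⊆ X ∨ {w | A w y} ⊆ X

/-- `T` is a strong component of the subdigraph induced on `S`: a maximal subset of
`S` inducing a strong subdigraph. -/
def IsStrongComponentOn (A : V → V → Prop) (S T : Set V) : Prop :=
  T ⊆ S ∧ StrongOn A T ∧ ∀ U : Set V, T ⊆ U → U ⊆ S → StrongOn A U → U = T

/-- `R 0, …, R (k-1)` is the linear decomposition of the subdigraph induced on `S`:
an ordered partition of `S` into nonempty sets, each of which is a strong component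
of the subdigraph induced on `S` or a subset of a single color class, with no arc
from a later part to an earlier one and at least one arc between consecutive parts. -/
def IsLinearDecompOn (A : V → V → Prop) (S : Set V) (k : ℕ) (R : Fin k → Set V) : Prop :=
  (∀ i, (R i).Nonempty ∧ R i ⊆ S) ∧
  (∀ v ∈ S, ∃! i, v ∈ R i) ∧
  (∀ i, IsStrongComponentOn A S (R i) ∨ ∃ v, R i ⊆ {u | SameClass A v u}) ∧
  (∀ i j : Fin k, i < j → ∀ a ∈ R j, ∀ b ∈ R i, ¬ A a b) ∧
  (∀ i : Fin k, ∀ h : (i : ℕ) + 1 < k, ∃ a ∈ R i, ∃ b ∈ R ⟨(i : ℕ) + 1, h⟩, A a b)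

/-- The digraph with arc relation `B` contains a directed cycle. -/
def HasCycle (B : V → V → Prop) : Prop :=
  ∃ c : List V, 2 ≤ c.length ∧ c.Nodup ∧ c.Chain' B ∧
    ∃ a b, c.head? = some a ∧ c.getLast? = some b ∧ B b a

theorem SameClass.symm {A : V → V → Prop} {u v : V} (h : SameClass A u v) :
    SameClass A v u :=
  h.imp Eq.symm And.symm

theorem IsPathFromTo.reverse {A : V → V → Prop} {S : Set V} {p : List V} {x y : V}
    (h : IsPathFromTo A S p x y) : IsPathFromTo (flip A) S p.reverse y x := by
  obtain ⟨⟨hne, hnd, hch, hS⟩, hx, hy⟩ := h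
  refine ⟨⟨by simpa using hne, List.nodup_reverse.2 hnd, ?_, by simpa using hS⟩,
    by simpa using hy, by simpa using hx⟩
  exact List.isChain_reverse.2 hch

/-- Replacing an arc `u → v` of a path by a detour `u → m → v` through new vertices. -/
theorem IsPathFromTo.insert_detour {A : V → V → Prop} {S : Set V} {x y u v : V}
    {s t m : List V} (hp : IsPathFromTo A S (s ++ u :: v :: t) x y)
    (hm : m.Nodup) (hdisj : ∀ w ∈ m, w ∉ s ++ u :: v :: t)
    (hch : List.IsChain A (u :: (m ++ [v]))) :
    IsPathFromTo A Set.univ (s ++ u :: (m ++ v :: t)) x y := by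
  obtain ⟨⟨-, hnd, hc, -⟩, hx, hy⟩ := hp
  replace hc : List.IsChain A (s ++ u :: v :: t) := hc
  refine ⟨⟨by simp, ?_, ?_, fun _ _ => Set.mem_univ _⟩, ?_, ?_⟩
  · have hperm : (s ++ u :: (m ++ v :: t)).Perm (m ++ (s ++ u :: v :: t)) := by
      have h := (List.perm_append_comm (l₁ := s ++ [u]) (l₂ := m)).append_right (v :: t)
      simpa using h
    rw [hperm.nodup_iff, List.nodup_append']
    exact ⟨hm, hnd, fun w hw hw' => hdisj w hw hw'⟩
  · change List.IsChain A _
    rw [List.isChain_split] at hc ⊢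
    refine ⟨hc.1, ?_⟩
    have h : List.IsChain A ((u :: m) ++ v :: t) := by
      rw [List.isChain_split]
      exact ⟨hch, (List.isChain_cons_cons.1 hc.2).2⟩
    exact h
  · cases s <;> simpa using hx
  · simpa [List.getLast?_append, List.getLast?_cons] using hy

/-- Along a list of vertices adjacent to `z` that starts with an in-neighbor of `z` and later
contains an out-neighbor of `z`, some in-neighbor is immediately followed by an out-neighbor. -/
theorem exists_consecutive_in_out {A : V → V → Prop} {z : V} (l : List V) (a : V)
    (hadj : ∀ w ∈ l, A w z ∨ A z w) (ha : A a z) (hw : ∃ w ∈ l, A z w) :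
    ∃ s u v t, a :: l = s ++ u :: v :: t ∧ A u z ∧ A z v := by
  induction l generalizing a with
  | nil => simp at hw
  | cons b l ih =>
    by_cases hb : A z b
    · exact ⟨[], a, b, l, rfl, ha, hb⟩
    · have hbz : A b z := (hadj b (by simp)).resolve_right hb
      obtain ⟨s, u, v, t, h, hu, hv⟩ := ih b (fun w hw => hadj w (by simp [hw])) hbz (by
        obtain ⟨w, hw, hzw⟩ := hw
        rcases List.mem_cons.1 hw with rfl | hw
        · exact absurd hzw hb
        · exact ⟨w, hw, hzw⟩)
      exact ⟨a :: s, u, v, t, by simp [h], hu, hv⟩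

/-- A list containing a vertex satisfying `P` splits at its first such vertex. -/
theorem exists_split_first {P : V → Prop} (l : List V) (h : ∃ w ∈ l, P w) :
    ∃ m v r, l = m ++ v :: r ∧ P v ∧ ∀ w ∈ m, ¬ P w := by
  induction l with
  | nil => simp at h
  | cons b l ih =>
    by_cases hb : P b
    · exact ⟨[], b, l, rfl, hb, by simp⟩
    · obtain ⟨m, v, r, rfl, hv, hm⟩ := ih (by
        obtain ⟨w, hw, hPw⟩ := h
        rcases List.mem_cons.1 hw with rfl | hw
        · exact absurd hPw hb
        · exact ⟨w, hw, hPw⟩)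
      exact ⟨b :: m, v, r, rfl, hv, by simpa [hb] using hm⟩

theorem IsPathFromTo.exists_insert {A : V → V → Prop} {x y u z v : V} {s t : List V}
    (hp : IsPathFromTo A ({z}ᶜ : Set V) (s ++ u :: v :: t) x y) (hu : A u z) (hv : A z v) :
    ∃ q, IsPathFromTo A Set.univ q x y ∧ z ∈ q ∧ ∀ w ∈ s ++ u :: v :: t, w ∈ q := by
  refine ⟨s ++ u :: ([z] ++ v :: t), hp.insert_detour (by simp) ?_ (by simp [hu, hv]),
    by simp, ?_⟩
  · intro w hw hwp
    exact hp.1.2.2.2 w hwp (by simpa using hw)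
  · intro w hw
    simp only [List.mem_append, List.mem_cons] at hw ⊢
    tauto

/-- A path from an in-neighbor `x` of `z`, all of whose vertices are adjacent to `z`, can be
rerouted through `z` as soon as its end can be reached from `z` without using `x`. -/
theorem IsPathFromTo.exists_through_of_adj_start {A : V → V → Prop} {x y z : V} {p : List V}
    (hp : IsPathFromTo A ({z}ᶜ : Set V) p x y) (hadj : ∀ w ∈ p, A w z ∨ A z w)
    (hxz : A x z) (hQ : ∃ Q, IsPathFromTo A ({x}ᶜ : Set V) Q z y) :
    ∃ q, IsPathFromTo A Set.univ q x y ∧ z ∈ q ∧ ∀ w ∈ p, w ∈ q := by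
  obtain ⟨l, rfl⟩ := List.head?_eq_some_iff.1 hp.2.1
  by_cases hout : ∃ w ∈ l, A z w
  · obtain ⟨s, u, v, t, h, hu, hv⟩ :=
      exists_consecutive_in_out l x (fun w hw => hadj w (by simp [hw])) hxz hout
    rw [h] at hp ⊢
    exact hp.exists_insert hu hv
  push Not at hout
  have hin : ∀ w ∈ x :: l, A w z := by
    intro w hw
    rcases List.mem_cons.1 hw with rfl | hw
    · exact hxz
    · exact (hadj w (by simp [hw])).resolve_right (hout w hw)
  obtain ⟨Q, ⟨-, hQnd, hQch, hQx⟩, hQz, hQy⟩ := hQ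
  have hyQ : y ∈ Q := List.mem_of_getLast? hQy
  have hyp : y ∈ x :: l := List.mem_of_getLast? hp.2.2
  obtain ⟨m, v, r, rfl, hv, hm⟩ := exists_split_first (P := fun w => w ∈ x :: l) Q ⟨y, hyQ, hyp⟩
  have hvx : v ≠ x := by simpa using hQx v (by simp)
  have hvl : v ∈ l := (List.mem_cons.1 hv).resolve_left hvx
  have hzl : z ∉ x :: l := fun h => hp.1.2.2.2 z h rfl
  obtain ⟨m', rfl⟩ : ∃ m', m = z :: m' := by
    cases m with
    | nil =>
      obtain rfl : v = z := by simpa using hQz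
      exact absurd hv hzl
    | cons a m' =>
      obtain rfl : a = z := by simpa using hQz
      exact ⟨m', rfl⟩
  obtain ⟨s', t, rfl⟩ := List.append_of_mem hvl
  obtain ⟨s, u, hs⟩ : ∃ s u, x :: s' = s ++ [u] :=
    ⟨_, _, (List.dropLast_append_getLast (List.cons_ne_nil x s')).symm⟩
  have hpeq : x :: (s' ++ v :: t) = s ++ u :: v :: t := by
    rw [← List.cons_append, hs]; simp
  rw [hpeq] at hp hin hm ⊢
  refine ⟨s ++ u :: ((z :: m') ++ v :: t), hp.insert_detour ?_ hm ?_, by simp, ?_⟩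
  · exact (List.nodup_append'.1 hQnd).1
  · replace hQch : List.IsChain A ((z :: m') ++ v :: r) := hQch
    rw [List.isChain_split] at hQch
    exact List.isChain_cons_cons.2 ⟨hin u (by simp), hQch.1⟩
  · intro w hw
    simp only [List.mem_append, List.mem_cons] at hw ⊢
    tauto

theorem ne_of_quasiHamiltonian {A : V → V → Prop} (hSMD : IsSMD A)
    (h2strong : KStrongOn A 2 (Set.univ : Set V)) {x y z : V} {p : List V}
    (hp : IsPathFromTo A ({z}ᶜ : Set V) p x y)
    (hcov : ∀ v : V, v ≠ z → ∃ u ∈ p, SameClass A u v) : x ≠ y := by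
  rintro rfl
  obtain ⟨l, rfl⟩ := List.head?_eq_some_iff.1 hp.2.1
  have hl : l = [] := by
    rcases List.eq_nil_or_concat l with rfl | ⟨l', b, rfl⟩
    · rfl
    · have hb : b = x := by simpa [List.getLast?_cons] using hp.2.2
      have := hp.1.2.1
      simp [hb] at this
  subst hl
  have hxz : x ≠ z := by simpa using hp.1.2.2.2 x (by simp)
  obtain ⟨w, -, hw⟩ : ∃ w ∈ (Set.univ : Set V), w ∉ ({x, z} : Set V) := by
    apply Set.exists_mem_notMem_of_ncard_lt_ncard _ (Set.toFinite _)
    have := h2strong.1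
    have := Set.ncard_pair hxz
    omega
  simp only [Set.mem_insert_iff, Set.mem_singleton_iff, not_or] at hw
  obtain ⟨q, ⟨-, -, hqch, hqz⟩, hqx, hqw⟩ := h2strong.2 {z} (Set.subset_univ _) (by simp)
    x (by simpa using hxz) w (by simpa using hw.2) (Ne.symm hw.1)
  obtain ⟨q', rfl⟩ := List.head?_eq_some_iff.1 hqx
  cases q' with
  | nil => exact hw.1 (by simpa using hqw.symm)
  | cons b q' =>
    have hxb : A x b := (List.isChain_cons_cons.1 hqch).1
    have hbz : b ≠ z := by simpa using hqz b (by simp)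
    obtain ⟨u, hu, hub⟩ := hcov b hbz
    obtain rfl : u = x := by simpa using hu
    rcases hub with rfl | h
    · exact hSMD.1 _ hxb
    · exact h.1 hxb

/-- Let `D` be a 2-strong SMD, and suppose `D - z` contains an
`(x,y)`-quasi-Hamiltonian path `p = v₀ v₁ … v_{ℓ+1}`. If (a) the color class of `z`
has more than one vertex, or (b) there are positions `i < j` on `p` with arcs
`vᵢ → z` and `z → vⱼ`, or (c) the arc `x → z` or the arc `z → y` exists, then `D`
contains an `(x,y)`-quasi-Hamiltonian path. -/
theorem stmt_2 {V : Type*} [Fintype V] (A : V → V → Prop)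
    (hSMD : IsSMD A) (h2strong : KStrongOn A 2 (Set.univ : Set V))
    (x y z : V) (p : List V)
    (hp : IsPathFromTo A ({z}ᶜ : Set V) p x y)
    (hcov : ∀ v : V, v ≠ z → ∃ u ∈ p, SameClass A u v)
    (hcond : (1 < {u | SameClass A z u}.ncard) ∨
      (∃ i j : Fin p.length, i < j ∧ A (p.get i) z ∧ A z (p.get j)) ∨
      (A x z ∨ A z y)) :
    ∃ q : List V, IsPathFromTo A Set.univ q x y ∧
      ∀ v : V, ∃ u ∈ q, SameClass A u v := by
  by_cases hz : ∃ w, w ≠ z ∧ SameClass A w z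
  · obtain ⟨w, hwz, hw⟩ := hz
    refine ⟨p, ⟨⟨hp.1.1, hp.1.2.1, hp.1.2.2.1, fun _ _ => Set.mem_univ _⟩, hp.2⟩, fun v => ?_⟩
    by_cases hv : v = z
    · obtain ⟨u, hu, huw⟩ := hcov w hwz
      exact ⟨u, hu, hv ▸ hSMD.2 _ _ _ huw hw⟩
    · exact hcov v hv
  push Not at hz
  have hadj : ∀ w, w ≠ z → A w z ∨ A z w := by
    intro w hw
    by_contra h
    exact hz w hw (Or.inr (not_or.1 h))
  have hpz : ∀ w ∈ p, w ≠ z := fun w hw => by simpa using hp.1.2.2.2 w hw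
  suffices h : ∃ q, IsPathFromTo A Set.univ q x y ∧ z ∈ q ∧ ∀ w ∈ p, w ∈ q by
    obtain ⟨q, hq, hzq, hpq⟩ := h
    refine ⟨q, hq, fun v => ?_⟩
    by_cases hv : v = z
    · exact ⟨z, hzq, Or.inl hv.symm⟩
    · obtain ⟨u, hu, huv⟩ := hcov v hv
      exact ⟨u, hpq u hu, huv⟩
  have hxy : x ≠ y := ne_of_quasiHamiltonian hSMD h2strong hp hcov
  have hxp : x ∈ p := List.mem_of_head? hp.2.1
  have hyp : y ∈ p := List.mem_of_getLast? hp.2.2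
  have hstrong : ∀ c a b : V, a ≠ c → b ≠ c → a ≠ b →
      ∃ Q, IsPathFromTo A ({c}ᶜ : Set V) Q a b := by
    intro c a b hac hbc hab
    have h := h2strong.2 {c} (Set.subset_univ _) (by simp)
    rw [← Set.compl_eq_univ_sdiff] at h
    exact h a (by simpa using hac) b (by simpa using hbc) hab
  rcases hcond with h | ⟨i, j, hij, hi, hj⟩ | hxz | hzy
  · exfalso
    have hsub : {u | SameClass A z u} ⊆ {z} := by
      intro u hu
      by_contra huz
      exact hz u huz (SameClass.symm hu)
    have := Set.ncard_le_ncard hsub (Set.toFinite _)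
    rw [Set.ncard_singleton] at this
    omega
  · have hsplit : p = p.take i ++ p.get i :: p.drop (i + 1) := by simp
    have hmem : p.get j ∈ p.drop (i + 1) := by
      rw [List.mem_iff_getElem]
      refine ⟨j - (i + 1), ?_, ?_⟩
      · have := j.2
        have : (i : ℕ) < j := hij
        simp only [List.length_drop]
        omega
      · have : (i : ℕ) < j := hij
        simp only [List.getElem_drop, List.get_eq_getElem]
        congr 1
        omega
    obtain ⟨s, u, v, t, h, hu, hv⟩ := exists_consecutive_in_out (p.drop (i + 1)) (p.get i)
      (fun w hw => hadj w (hpz w (List.mem_of_mem_drop hw))) hi ⟨_, hmem, hj⟩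
    have hpeq : p = (p.take i ++ s) ++ u :: v :: t := by
      rw [List.append_assoc, ← h]; exact hsplit
    rw [hpeq] at hp
    obtain ⟨q, hq⟩ := hp.exists_insert hu hv
    rw [← hpeq] at hq
    exact ⟨q, hq⟩
  · exact hp.exists_through_of_adj_start (fun w hw => hadj w (hpz w hw)) hxz
      (hstrong x z y (hpz x hxp).symm hxy.symm (hpz y hyp).symm)
  · obtain ⟨Q, hQ⟩ := hstrong y x z hxy (hpz y hyp).symm (hpz x hxp)
    obtain ⟨q, hq, hzq, hpq⟩ := hp.reverse.exists_through_of_adj_start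
      (fun w hw => (hadj w (hpz w (by simpa using hw))).symm) hzy ⟨_, hQ.reverse⟩
    exact ⟨q.reverse, hq.reverse, by simpa using hzq, by simpa using hpq⟩
end

section
/- Let D be a semicomplete multipartite digraph with independence number α(D) ≤ 2. Then D is unilaterally connected if and only if D contains a Hamiltonian path. -/
open Set

variable {V : Type*}

section CycleMerging

open Equiv

variable {W : Type*}

/-- No arc of `B` joins `a` and `b`. -/
def NonAdj (B : W → W → Prop) (a b : W) : Prop := ¬ B a b ∧ ¬ B b a

theorem NonAdj.symm {B : W → W → Prop} {a b : W} (h : NonAdj B a b) : NonAdj B b a :=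
  ⟨h.2, h.1⟩

theorem mul_swap_apply_of_ne [DecidableEq W] (σ : Perm W) {x y z : W} (hx : z ≠ x)
    (hy : z ≠ y) : (σ * swap x y) z = σ z := by
  rw [Perm.mul_apply, swap_apply_of_ne_of_ne hx hy]

/-- Multiplying by a transposition of points of two different cycles merges these cycles. -/
theorem sameCycle_mul_swap_self [Finite W] [DecidableEq W] {σ : Perm W} {x y : W}
    (hxy : ¬ σ.SameCycle x y) : (σ * swap x y).SameCycle x y := by
  have h0 : (σ * swap x y).SameCycle x (σ y) := by
    have : (σ * swap x y) x = σ y := by simp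
    rw [← this]; exact Perm.sameCycle_apply_right.2 (Perm.SameCycle.refl _ _)
  have key : ∀ n : ℕ, (σ * swap x y).SameCycle x ((σ ^ (n + 1)) y) ∨
      (σ * swap x y).SameCycle x y := by
    intro n
    induction n with
    | zero => left; simpa using h0
    | succ n ih =>
      rcases ih with ih | ih
      · by_cases hy : (σ ^ (n + 1)) y = y
        · right; rwa [hy] at ih
        · left
          have hx : (σ ^ (n + 1)) y ≠ x := by
            intro h
            exact hxy (Perm.SameCycle.symm ⟨(n + 1 : ℕ), by rw [zpow_natCast]; exact h⟩)
          have := mul_swap_apply_of_ne σ hx hy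
          rw [pow_succ', Perm.mul_apply, ← this]
          exact Perm.sameCycle_apply_right.2 ih
      · exact Or.inr ih
  have hpos : 0 < orderOf σ := orderOf_pos σ
  rcases key (orderOf σ - 1) with h | h
  · rw [Nat.sub_add_cancel hpos, pow_orderOf_eq_one] at h
    exact h
  · exact h

theorem Equiv.Perm.SameCycle.mul_swap [Finite W] [DecidableEq W] {σ : Perm W} {x y : W}
    (hxy : ¬ σ.SameCycle x y) {a b : W} (hab : σ.SameCycle a b) :
    (σ * swap x y).SameCycle a b := by
  have hs := sameCycle_mul_swap_self hxy
  have hstep : ∀ z, (σ * swap x y).SameCycle z (σ z) := by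
    intro z
    by_cases hzx : z = x
    · subst hzx
      have : (σ * swap z y) y = σ z := by simp
      rw [← this]
      exact Perm.sameCycle_apply_right.2 hs
    by_cases hzy : z = y
    · subst hzy
      have : (σ * swap x z) x = σ z := by simp
      rw [← this]
      exact Perm.sameCycle_apply_right.2 hs.symm
    · rw [← mul_swap_apply_of_ne σ hzx hzy]
      exact Perm.sameCycle_apply_right.2 (Perm.SameCycle.refl _ _)
  obtain ⟨n, rfl⟩ := hab.exists_nat_pow_eq
  induction n with
  | zero => exact Perm.SameCycle.refl _ _
  | succ n ih =>
    rw [pow_succ', Perm.mul_apply]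
    exact (ih ⟨n, by simp⟩).trans (hstep _)

/-- In a cycle factor, start at a position `i` on the cycle of `o` with a vertex `w` of another
cycle that has no arc to it, and move forward along the first cycle and backward along the second.
If no transposition merges the two cycles, a nonadjacent pair is met before returning to `o`. -/
theorem exists_nonAdj_of_not_arc {B : W → W → Prop} {o : W} (hto : ∀ w, B w o)
    {σ : Perm W}
    (hmerge : ∀ x y, σ.SameCycle o x → ¬ σ.SameCycle o y → B x (σ y) → ¬ B y (σ x))
    {N : ℕ} (hN : (σ ^ N) o = o) {i : ℕ} (hi : i ≤ N) {w : W} (hw : ¬ σ.SameCycle o w)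
    (hB : ¬ B w ((σ ^ i) o)) :
    ∃ j y, i ≤ j ∧ j < N ∧ (σ ^ j) y = (σ ^ i) w ∧ NonAdj B ((σ ^ j) o) y := by
  induction hk : N - i generalizing i w with
  | zero =>
    obtain rfl : i = N := by omega
    rw [hN] at hB
    exact absurd (hto w) hB
  | succ k ih =>
    by_cases hB' : B ((σ ^ i) o) w
    · have hw' : ¬ σ.SameCycle o (σ⁻¹ w) := by simpa using hw
      have hn := hmerge ((σ ^ i) o) (σ⁻¹ w) (Perm.sameCycle_pow_right.2 (.refl _ _)) hw' (by simpa using hB')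
      rw [← Perm.mul_apply, ← pow_succ'] at hn
      obtain ⟨j, y, hij, hj, hy, hna⟩ := ih (by omega) hw' hn (by omega)
      refine ⟨j, y, by omega, hj, ?_, hna⟩
      rw [hy, pow_succ, Perm.mul_apply]
      simp
    · exact ⟨i, w, le_rfl, by omega, rfl, hB', hB⟩

/-- If no transposition merges the cycle of `o` with another cycle, then two nonadjacent pairs
lying on the same diagonal are at the same position. -/
theorem nonAdj_position_unique [Finite W] {B : W → W → Prop} {o : W} (hof : ∀ w, B o w)
    (hto : ∀ w, B w o)
    (hpart : ∀ a b c, NonAdj B a b → NonAdj B a c → a ≠ b → a ≠ c → b = c)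
    {σ : Perm W}
    (hmerge : ∀ x y, σ.SameCycle o x → ¬ σ.SameCycle o y → B x (σ y) → ¬ B y (σ x))
    {N : ℕ} (hN : (σ ^ N) o = o) (hpos : 0 < N)
    (hinj : ∀ i < N, ∀ j < N, (σ ^ i) o = (σ ^ j) o → i = j)
    {i j : ℕ} (hi : i < N) (hj : j < N) {y z : W} (hy : ¬ σ.SameCycle o y)
    (hna : NonAdj B ((σ ^ i) o) y) (hna' : NonAdj B ((σ ^ j) o) z)
    (hdiag : (σ ^ i) y = (σ ^ j) z) : i = j := by
  have huniq : ∀ {i j : ℕ}, i < N → j < N → ∀ {y}, ¬ σ.SameCycle o y →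
      NonAdj B ((σ ^ i) o) y → NonAdj B ((σ ^ j) o) y → i = j := by
    intro i j hi hj y hy h1 h2
    have hne : ∀ k : ℕ, y ≠ (σ ^ k) o := by
      rintro k rfl
      exact hy (Perm.sameCycle_pow_right.2 (.refl _ _))
    exact hinj i hi j hj (hpart y _ _ h1.symm h2.symm (hne _) (hne _))
  have hex : ∀ d : {w // ¬ σ.SameCycle o w}, ∃ k < N, ∃ y : {w // ¬ σ.SameCycle o w},
      (σ ^ k) y.1 = d.1 ∧ NonAdj B ((σ ^ k) o) y.1 := by
    rintro ⟨d, hd⟩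
    have hd' : ¬ σ.SameCycle o (σ⁻¹ d) := by simpa using hd
    have h1 : ¬ B (σ⁻¹ d) ((σ ^ 1) o) := by
      rw [pow_one]
      exact hmerge o (σ⁻¹ d) (Perm.SameCycle.refl _ _) hd' (hof _)
    obtain ⟨k, y, -, hk, hy, hn⟩ := exists_nonAdj_of_not_arc hto hmerge hN hpos hd' h1
    have hyd : (σ ^ k) y = d := by rw [hy]; simp
    refine ⟨k, hk, ⟨y, fun h => hd ?_⟩, hyd, hn⟩
    rw [← hyd]
    simpa using h
  choose pos hposN F hFd hFn using hex
  have hFinj : Function.Injective F := by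
    intro d e hde
    have hp : pos d = pos e :=
      huniq (hposN d) (hposN e) (F d).2 (hFn d) (by rw [hde]; exact hFn e)
    apply Subtype.ext
    rw [← hFd d, ← hFd e, hp, hde]
  have hFsurj := Finite.surjective_of_injective hFinj
  have hz : ¬ σ.SameCycle o z := by
    intro h
    apply hy
    have : σ.SameCycle o ((σ ^ i) y) := by rw [hdiag]; simpa using h
    simpa using this
  have hF : ∀ {k y} (hk : k < N) (hy : ¬ σ.SameCycle o y), NonAdj B ((σ ^ k) o) y →
      ∃ d, d.1 = (σ ^ k) y ∧ F d = ⟨y, hy⟩ := by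
    intro k y hk hy hn
    obtain ⟨d, hd⟩ := hFsurj ⟨y, hy⟩
    refine ⟨d, ?_, hd⟩
    have hn' := hFn d
    have hd' := hFd d
    rw [hd] at hn' hd'
    rw [← hd', huniq hk (hposN d) hy hn hn']
  obtain ⟨d, hd, hFd1⟩ := hF hi hy hna
  obtain ⟨e, he, hFe1⟩ := hF hj hz hna'
  obtain rfl : d = e := Subtype.ext (by rw [hd, he, hdiag])
  obtain rfl : y = z := congrArg Subtype.val (hFd1.symm.trans hFe1)
  exact huniq hi hj hy hna hna'

/-- A cycle factor whose cycle through the universal vertex `o` is not Hamiltonian can be changed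
into one in which that cycle is strictly larger. -/
theorem exists_larger_cycle [Finite W] {B : W → W → Prop} {o : W} (hof : ∀ w, B o w)
    (hto : ∀ w, B w o)
    (hadj : ∀ a b c, NonAdj B a b → (B b c ∨ B c b) → (B a c ∨ B c a))
    (hpart : ∀ a b c, NonAdj B a b → NonAdj B a c → a ≠ b → a ≠ c → b = c)
    {σ : Perm W} (hσ : ∀ x, B x (σ x)) {y₀ : W} (hy₀ : ¬ σ.SameCycle o y₀) :
    ∃ τ : Perm W, (∀ x, B x (τ x)) ∧ (∀ w, σ.SameCycle o w → τ.SameCycle o w) ∧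
      ∃ y, ¬ σ.SameCycle o y ∧ τ.SameCycle o y := by
  classical
  by_cases hmerge : ∀ x y, σ.SameCycle o x → ¬ σ.SameCycle o y → B x (σ y) → ¬ B y (σ x)
  swap
  · push Not at hmerge
    obtain ⟨x, y, hx, hy, h1, h2⟩ := hmerge
    have hxy : ¬ σ.SameCycle x y := fun h => hy (hx.trans h)
    refine ⟨σ * swap x y, fun w => ?_, fun w hw => hw.mul_swap hxy, y, hy,
      (hx.mul_swap hxy).trans (sameCycle_mul_swap_self hxy)⟩
    by_cases hwx : w = x
    · subst hwx; simpa using h1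
    by_cases hwy : w = y
    · subst hwy; simpa using h2
    rw [mul_swap_apply_of_ne σ hwx hwy]
    exact hσ w
  set N := Function.minimalPeriod σ o with hNdef
  have hpos : 0 < N :=
    Function.minimalPeriod_pos_of_mem_periodicPts (σ.injective.mem_periodicPts o)
  have hN : (σ ^ N) o = o := by
    rw [← Perm.iterate_eq_pow]; exact Function.iterate_minimalPeriod
  have hinj : ∀ i < N, ∀ j < N, (σ ^ i) o = (σ ^ j) o → i = j := by
    intro i hi j hj h
    rw [← Perm.iterate_eq_pow, ← Perm.iterate_eq_pow] at h
    exact Function.iterate_injOn_Iio_minimalPeriod hi hj h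
  have hex : ∃ n, ∃ y, ¬ σ.SameCycle o y ∧ B y ((σ ^ (n + 1)) o) :=
    ⟨N - 1, y₀, hy₀, by rw [Nat.sub_add_cancel hpos, hN]; exact hto _⟩
  obtain ⟨y, hy, hyx1⟩ := Nat.find_spec hex
  have hmin : ∀ m < Nat.find hex, ∀ y, ¬ σ.SameCycle o y → ¬ B y ((σ ^ (m + 1)) o) :=
    fun m hm y hy h => Nat.find_min hex hm ⟨y, hy, h⟩
  have hnN : Nat.find hex ≤ N - 1 :=
    Nat.find_min' hex ⟨y₀, hy₀, by rw [Nat.sub_add_cancel hpos, hN]; exact hto _⟩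
  generalize Nat.find hex = n at *
  have hno : ∀ y, ¬ σ.SameCycle o y → ¬ B y ((σ ^ n) o) := by
    intro v hv
    cases n with
    | zero =>
      exfalso
      rw [zero_add, pow_one] at hyx1
      exact hmerge o y (Perm.SameCycle.refl _ _) hy (hof _) hyx1
    | succ m => exact hmin m (by omega) v hv
  set x := (σ ^ n) o with hx
  set x1 := σ x with hx1
  have hpow1 : (σ ^ (n + 1)) o = x1 := by rw [pow_succ', Perm.mul_apply]
  have hpow2 : (σ ^ (n + 2)) o = σ x1 := by rw [pow_succ', Perm.mul_apply, hpow1]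
  rw [hpow1] at hyx1
  have hox : σ.SameCycle o x := Perm.sameCycle_pow_right.2 (.refl _ _)
  have hox1 : σ.SameCycle o x1 := by simpa [hx1] using hox
  have hσy : ¬ σ.SameCycle o (σ y) := by simpa using hy
  have hσσy : ¬ σ.SameCycle o (σ (σ y)) := by simpa using hy
  have hnaxy : NonAdj B x (σ y) :=
    ⟨fun h => hmerge x y hox hy h hyx1, hno _ hσy⟩
  have hxy : B x y := (hadj _ _ _ hnaxy (Or.inr (hσ y))).resolve_right (hno y hy)
  have hx1σy : B x1 (σ y) := by
    refine (hadj _ _ _ hnaxy.symm (Or.inl (hσ x))).resolve_left fun h => ?_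
    have h1 : ¬ B x (σ (σ y)) := fun h' => hmerge x (σ y) hox hσy h' h
    exact (hadj _ _ _ hnaxy (Or.inl (hσ (σ y)))).elim h1 (hno _ hσσy)
  obtain ⟨z, hzy⟩ : ∃ z, σ z = y := ⟨σ⁻¹ y, by simp⟩
  have hz : ¬ σ.SameCycle o z := by
    rw [← hzy] at hy; simpa using hy
  have hx1o : x1 ≠ o := by
    intro h
    refine hmerge x z hox hz (by rwa [hzy]) ?_
    rw [← hx1, h]
    exact hto z
  have hn1 : n + 1 < N := by
    rcases Nat.lt_or_ge (n + 1) N with h | h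
    · exact h
    · obtain h : n + 1 = N := by omega
      rw [h, hN] at hpow1
      exact absurd hpow1.symm hx1o
  have hzx2 : B z (σ x1) := by
    by_contra hcon
    rw [← hpow2] at hcon
    obtain ⟨j, y', hij, hj, hdiag, hna⟩ :=
      exists_nonAdj_of_not_arc hto hmerge hN (by omega) hz hcon
    have : n = j := by
      refine nonAdj_position_unique hof hto hpart hmerge hN hpos hinj (by omega) hj hσy hnaxy hna ?_
      rw [hdiag, pow_succ, pow_succ, Perm.mul_apply, Perm.mul_apply, hzy]
    omega
  have hcyc : ∀ {a b}, σ.SameCycle o a → ¬ σ.SameCycle o b → a ≠ b := by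
    rintro a b ha hb rfl
    exact hb ha
  have hx1y := hcyc hox1 hy
  have hx1z := hcyc hox1 hz
  have hzney : z ≠ y := by
    rintro rfl
    rw [hzy] at hnaxy
    exact hnaxy.1 hxy
  have hxx1 : x ≠ x1 := by
    intro h
    exact hnaxy.1 (h ▸ hx1σy)
  have hx1z' : ¬ σ.SameCycle x1 z := fun h => hz (hox1.trans h)
  refine ⟨swap x1 y * (σ * swap x1 z) * (swap x1 y)⁻¹, fun w => ?_, ?_⟩
  · simp only [swap_inv, Perm.mul_apply]
    by_cases h1 : w = x1
    · subst h1
      rw [swap_apply_left, swap_apply_of_ne_of_ne hx1y.symm hzney.symm,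
        swap_apply_of_ne_of_ne (hcyc hox1 hσy).symm]
      · exact hx1σy
      · intro h
        rw [h] at hnaxy
        exact hnaxy.1 hxy
    by_cases h2 : w = y
    · subst h2
      rw [swap_apply_right, swap_apply_left, hzy, swap_apply_right]
      exact hyx1
    by_cases h3 : w = z
    · subst h3
      rw [swap_apply_of_ne_of_ne h1 h2, swap_apply_right, swap_apply_of_ne_of_ne]
      · exact hzx2
      · intro h
        rw [hx1] at h
        exact hxx1 (σ.injective h).symm
      · exact hcyc (by simpa using hox1) hy
    rw [swap_apply_of_ne_of_ne h1 h2, swap_apply_of_ne_of_ne h1 h3]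
    by_cases h4 : w = x
    · subst h4
      rw [← hx1, swap_apply_left]
      exact hxy
    rw [swap_apply_of_ne_of_ne]
    · exact hσ w
    · intro h
      exact h4 (σ.injective h)
    · intro h
      exact h3 (σ.injective (h.trans hzy.symm))
  · have hoz : (σ * swap x1 z).SameCycle o z :=
      (hox1.mul_swap hx1z').trans (sameCycle_mul_swap_self hx1z')
    have hzy' : σ.SameCycle z y := ⟨1, by simpa using hzy⟩
    have hoy : (σ * swap x1 z).SameCycle o y := hoz.trans (hzy'.mul_swap hx1z')
    have hox1' := hox1.mul_swap hx1z'
    have hswap : ∀ w, (σ * swap x1 z).SameCycle o w →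
        (σ * swap x1 z).SameCycle o (swap x1 y w) := by
      intro w hw
      by_cases h1 : w = x1
      · rw [h1, swap_apply_left]; exact hoy
      by_cases h2 : w = y
      · rw [h2, swap_apply_right]; exact hox1'
      rwa [swap_apply_of_ne_of_ne h1 h2]
    have hlift : ∀ w, (σ * swap x1 z).SameCycle o w →
        (swap x1 y * (σ * swap x1 z) * (swap x1 y)⁻¹).SameCycle o w := by
      intro w hw
      rw [Perm.sameCycle_conj, swap_inv]
      exact (hswap o (Perm.SameCycle.refl _ _)).symm.trans (hswap w hw)
    exact ⟨fun w hw => hlift w (hw.mul_swap hx1z'), y, hy, hlift y hoy⟩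

/-- A cycle factor can be improved to a Hamiltonian cycle. -/
theorem exists_hamiltonian_perm [Finite W] {B : W → W → Prop} {o : W} (hof : ∀ w, B o w)
    (hto : ∀ w, B w o)
    (hadj : ∀ a b c, NonAdj B a b → (B b c ∨ B c b) → (B a c ∨ B c a))
    (hpart : ∀ a b c, NonAdj B a b → NonAdj B a c → a ≠ b → a ≠ c → b = c)
    {σ : Perm W} (hσ : ∀ x, B x (σ x)) :
    ∃ τ : Perm W, (∀ x, B x (τ x)) ∧ ∀ w, τ.SameCycle o w := by
  obtain ⟨τ, hτ, hmax⟩ := Set.exists_max_image {τ : Perm W | ∀ x, B x (τ x)}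
    (fun τ => {w | τ.SameCycle o w}.ncard) (Set.toFinite _) ⟨σ, hσ⟩
  refine ⟨τ, hτ, fun w => ?_⟩
  by_contra hw
  obtain ⟨ρ, hρ, hsub, y, hy, hy'⟩ := exists_larger_cycle hof hto hadj hpart hτ hw
  refine absurd (hmax ρ hρ) (not_le.2 (Set.ncard_lt_ncard ?_ (Set.toFinite _)))
  exact (Set.ssubset_iff_of_subset hsub).2 ⟨y, hy', hy⟩

end CycleMerging

section Cone

open Equiv

/-- The digraph `A` together with a new vertex `none` joined to all vertices in both directions. -/
def cone {V : Type*} (A : V → V → Prop) : Option V → Option V → Prop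
  | some a, some b => A a b
  | _, _ => True

theorem cone_none_left {V : Type*} (A : V → V → Prop) (w : Option V) : cone A none w := by
  cases w <;> trivial

theorem cone_none_right {V : Type*} (A : V → V → Prop) (w : Option V) : cone A w none := by
  cases w <;> trivial

/-- A Hamiltonian cycle of the cone yields a Hamiltonian path. -/
theorem exists_path_of_cone_perm {V : Type*} [Finite V] {A : V → V → Prop}
    {σ : Perm (Option V)} (hσ : ∀ x, cone A x (σ x)) (hall : ∀ w, σ.SameCycle none w) :
    ∃ p : List V, p.Nodup ∧ p.IsChain A ∧ ∀ v, v ∈ p := by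
  set N := Function.minimalPeriod σ none with hNdef
  have hpos : 0 < N :=
    Function.minimalPeriod_pos_of_mem_periodicPts (σ.injective.mem_periodicPts none)
  have hinj : ∀ i < N, ∀ j < N, (σ ^ i) none = (σ ^ j) none → i = j := by
    intro i hi j hj h
    rw [← Perm.iterate_eq_pow, ← Perm.iterate_eq_pow] at h
    exact Function.iterate_injOn_Iio_minimalPeriod hi hj h
  have hsome : ∀ i : Fin (N - 1), ∃ v, (σ ^ (i.1 + 1)) none = some v := by
    intro i
    refine Option.ne_none_iff_exists'.1 fun h => ?_
    have := hinj (i.1 + 1) (by omega) 0 hpos (by simpa using h)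
    omega
  choose g hg using hsome
  refine ⟨List.ofFn g, List.nodup_ofFn.2 ?_, List.isChain_ofFn.2 ?_, ?_⟩
  · intro i j hij
    have := hinj (i.1 + 1) (by omega) (j.1 + 1) (by omega) (by rw [hg, hg, hij])
    exact Fin.ext (by omega)
  · intro i hi
    have h := hσ (some (g ⟨i, by omega⟩))
    rw [← hg, ← Perm.mul_apply, ← pow_succ', hg, hg ⟨i + 1, hi⟩] at h
    exact h
  · intro v
    obtain ⟨n, hn⟩ := (hall (some v)).exists_nat_pow_eq
    rw [← Perm.iterate_eq_pow, ← Function.iterate_mod_minimalPeriod_eq, ← hNdef] at hn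
    have hlt := Nat.mod_lt n hpos
    generalize n % N = m at hn hlt
    cases m with
    | zero => simp at hn
    | succ m =>
      rw [Perm.iterate_eq_pow, hg ⟨m, by omega⟩] at hn
      rw [List.mem_ofFn]
      exact ⟨_, Option.some.inj hn⟩

end Cone

theorem NonAdj.adj_of_adj {V : Type*} {A : V → V → Prop} (hSMD : IsSMD A) {a b c : V}
    (hab : NonAdj A a b) (hbc : A b c ∨ A c b) : A a c ∨ A c a := by
  by_contra hcon
  push Not at hcon
  rcases hSMD.2 b a c (Or.inr hab.symm) (Or.inr hcon) with rfl | h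
  · exact hbc.elim (hSMD.1 _) (hSMD.1 _)
  · exact hbc.elim h.1 h.2

theorem ncard_sameClass_le {V : Type*} [Fintype V] (A : V → V → Prop) (v : V) :
    {u | SameClass A v u}.ncard ≤ indepNum A :=
  Finset.le_sup (f := fun v : V => {u | SameClass A v u}.ncard) (Finset.mem_univ v)

theorem nonAdj_unique {V : Type*} [Fintype V] {A : V → V → Prop} (halpha : indepNum A ≤ 2)
    {a b c : V} (hab : NonAdj A a b) (hac : NonAdj A a c) (h1 : a ≠ b) (h2 : a ≠ c) : b = c := by
  by_contra h3
  have hsub : ({a, b, c} : Set V) ⊆ {u | SameClass A a u} := by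
    rintro u (rfl | rfl | rfl)
    · exact Or.inl rfl
    · exact Or.inr hab
    · exact Or.inr hac
  have hle := Set.ncard_le_ncard hsub (Set.toFinite _)
  rw [Set.ncard_eq_three.2 ⟨a, b, c, h1, h2, h3, rfl⟩] at hle
  have := ncard_sameClass_le A a
  omega

theorem reflTransGen_of_isPathFromTo {V : Type*} {A : V → V → Prop} {S : Set V} {p : List V}
    {x y : V} (h : IsPathFromTo A S p x y) : Relation.ReflTransGen A x y := by
  obtain ⟨⟨hne, -, hch, -⟩, hx, hy⟩ := h
  have := List.relationReflTransGen_of_exists_isChain p hch hne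
  rw [List.head?_eq_some_head hne, Option.some.injEq] at hx
  rw [List.getLast?_eq_some_getLast hne, Option.some.injEq] at hy
  rwa [hx, hy] at this

/-- In a unilaterally connected digraph with independence number at most two, every vertex set `S`
has at least `|S| - 1` out-neighbors. -/
theorem card_le_card_outNeighbors_add_one {V : Type*} [Fintype V] [DecidableEq V]
    {A : V → V → Prop} [DecidableRel A] (halpha : indepNum A ≤ 2) (hU : Unilateral A)
    (S : Finset V) :
    S.card ≤ (S.biUnion fun v => Finset.univ.filter (A v)).card + 1 := by
  set T := S.biUnion fun v => Finset.univ.filter (A v) with hT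
  have hmem : ∀ {a b}, a ∈ S → A a b → b ∈ T := by
    intro a b ha hab
    rw [hT, Finset.mem_biUnion]
    exact ⟨a, ha, by simpa using hab⟩
  by_contra! hlt
  have hsplit := Finset.card_sdiff_add_card_inter S T
  have hinter := Finset.card_le_card (Finset.inter_subset_right (s₁ := S) (s₂ := T))
  obtain ⟨x, hx, y, hy, hxy⟩ := Finset.one_lt_card.1 (show 1 < (S \ T).card by omega)
  rw [Finset.mem_sdiff] at hx hy
  have hle : (S \ T).card ≤ 2 := by
    refine le_trans ?_ ((ncard_sameClass_le A x).trans halpha)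
    rw [← Set.ncard_coe_finset]
    refine Set.ncard_le_ncard (fun u hu => Or.inr ?_) (Set.toFinite _)
    rw [Finset.mem_coe, Finset.mem_sdiff] at hu
    exact ⟨fun h => hu.2 (hmem hx.1 h), fun h => hx.2 (hmem hu.1 h)⟩
  have hTS : T ⊆ S := by
    have : S ∩ T = T := Finset.eq_of_subset_of_card_le Finset.inter_subset_right (by omega)
    exact Finset.inter_eq_right.1 this
  have hreach : ∀ {a b}, a ∈ S → b ∉ T → a ≠ b → ¬ Relation.ReflTransGen A a b := by
    intro a b ha hb hab h
    have hS : ∀ {c}, Relation.ReflTransGen A a c → c ∈ S := by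
      intro c hc
      induction hc with
      | refl => exact ha
      | tail _ h ih => exact hTS (hmem ih h)
    rcases Relation.ReflTransGen.cases_tail h with h | ⟨c, hc, hcb⟩
    · exact hab h.symm
    · exact hb (hmem (hS hc) hcb)
  rcases hU x y hxy with ⟨p, hp⟩ | ⟨p, hp⟩
  · exact hreach hx.1 hy.2 hxy (reflTransGen_of_isPathFromTo hp)
  · exact hreach hy.1 hx.2 hxy.symm (reflTransGen_of_isPathFromTo hp)

/-- The cone over a unilaterally connected digraph with independence number at most two has a
cycle factor. -/
theorem exists_cone_cycle_factor {V : Type*} [Fintype V] {A : V → V → Prop}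
    (halpha : indepNum A ≤ 2) (hU : Unilateral A) :
    ∃ σ : Equiv.Perm (Option V), ∀ x, cone A x (σ x) := by
  classical
  obtain ⟨f, hf, hfA⟩ := (Finset.all_card_le_biUnion_card_iff_exists_injective
    (fun x : Option V => Finset.univ.filter (cone A x))).1 (by
      intro s
      by_cases hs : none ∈ s
      · refine Finset.card_le_card fun x _ => Finset.mem_biUnion.2 ⟨none, hs, ?_⟩
        simpa using cone_none_left A x
      rcases s.eq_empty_or_nonempty with rfl | ⟨w, hw⟩
      · simp
      have hcard : s.eraseNone.card = s.card := by
        rw [Finset.card_eraseNone_of_not_mem hs]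
      have h1 := card_le_card_outNeighbors_add_one halpha hU s.eraseNone
      rw [hcard] at h1
      refine h1.trans ?_
      rw [← Finset.card_insertNone]
      refine Finset.card_le_card fun x hx => Finset.mem_biUnion.2 ?_
      cases x with
      | none => exact ⟨w, hw, by simpa using cone_none_right A w⟩
      | some b =>
        rw [Finset.some_mem_insertNone, Finset.mem_biUnion] at hx
        obtain ⟨a, ha, hab⟩ := hx
        refine ⟨some a, by simpa using ha, ?_⟩
        simpa [cone] using hab)
  refine ⟨Equiv.ofBijective f (Finite.injective_iff_bijective.1 hf), fun x => ?_⟩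
  simpa using hfA x

theorem exists_isPathFromTo_of_infix {V : Type*} {A : V → V → Prop} {p l : List V} {x y : V}
    (hnd : p.Nodup) (hch : p.IsChain A) (h : x :: l ++ [y] <:+: p) :
    ∃ q, IsPathFromTo A Set.univ q x y :=
  ⟨x :: l ++ [y], ⟨by simp, hnd.sublist h.sublist, hch.infix h, fun _ _ => Set.mem_univ _⟩,
    rfl, List.getLast?_concat⟩

theorem unilateral_of_hamiltonian_path {V : Type*} {A : V → V → Prop} {p : List V}
    (hnd : p.Nodup) (hch : p.IsChain A) (hall : ∀ v, v ∈ p) : Unilateral A := by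
  intro x y hxy
  obtain ⟨s, t, rfl⟩ := List.append_of_mem (hall x)
  have hy := hall y
  rw [List.mem_append, List.mem_cons] at hy
  rcases hy with hy | rfl | hy
  · obtain ⟨u, v, rfl⟩ := List.append_of_mem hy
    exact Or.inr (exists_isPathFromTo_of_infix (l := v) hnd hch ⟨u, t, by simp⟩)
  · exact absurd rfl hxy
  · obtain ⟨u, v, rfl⟩ := List.append_of_mem hy
    exact Or.inl (exists_isPathFromTo_of_infix (l := u) hnd hch ⟨s, v, by simp⟩)

/-- An SMD with independence number at most 2 is unilaterally
connected iff it contains a Hamiltonian path. -/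
theorem stmt_6 {V : Type*} [Fintype V] (A : V → V → Prop)
    (hSMD : IsSMD A) (halpha : indepNum A ≤ 2) :
    Unilateral A ↔ ∃ p : List V, p.Nodup ∧ p.Chain' A ∧ ∀ v, v ∈ p := by
  refine ⟨fun hU => ?_, fun ⟨p, hnd, hch, hall⟩ => unilateral_of_hamiltonian_path hnd hch hall⟩
  obtain ⟨σ, hσ⟩ := exists_cone_cycle_factor halpha hU
  suffices h : ∃ τ : Equiv.Perm (Option V), (∀ x, cone A x (τ x)) ∧ ∀ w, τ.SameCycle none w by
    obtain ⟨τ, hτ, hall⟩ := h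
    exact exists_path_of_cone_perm hτ hall
  refine exists_hamiltonian_perm (cone_none_left A) (cone_none_right A) ?_ ?_ hσ
  · intro a b c hab hbc
    rcases a with _ | a
    · exact absurd (cone_none_left A b) hab.1
    rcases b with _ | b
    · exact absurd (cone_none_right A _) hab.1
    rcases c with _ | c
    · exact Or.inl (cone_none_right A _)
    exact NonAdj.adj_of_adj (A := A) hSMD hab hbc
  · intro a b c hab hac h1 h2
    rcases a with _ | a
    · exact absurd (cone_none_left A b) hab.1
    rcases b with _ | b
    · exact absurd (cone_none_right A _) hab.1
    rcases c with _ | c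
    · exact absurd (cone_none_right A _) hac.1
    exact congrArg some (nonAdj_unique (A := A) halpha hab hac
      (fun h => h1 (congrArg some h)) (fun h => h2 (congrArg some h)))
end

section
/- A semicomplete multipartite digraph D is unilaterally connected if and only if no element of its linear decomposition is an independent set of size at least 2; equivalently, every element R_i of the linear decomposition of D either is a singleton or induces a strong subdigraph of D. -/
open Set

variable {V : Type*}

open Relation in
theorem IsPathFromTo.reflTransGen {A : V → V → Prop} {S : Set V} {p : List V} {x y : V}
    (h : IsPathFromTo A S p x y) : ReflTransGen A x y := by
  obtain ⟨⟨-, -, hc, -⟩, hx, hy⟩ := h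
  induction p generalizing x with
  | nil => simp at hx
  | cons a t ih =>
    obtain rfl : a = x := by simpa using hx
    cases t with
    | nil =>
      obtain rfl : a = y := by simpa using hy
      exact .refl
    | cons b t =>
      obtain ⟨hab, hc⟩ := List.isChain_cons_cons.mp hc
      exact .head hab (ih hc rfl (by simpa [List.getLast?_cons_cons] using hy))

open Relation in
theorem exists_isPathFromTo_univ_of_reflTransGen {A : V → V → Prop} {x y : V}
    (h : ReflTransGen A x y) : ∃ p, IsPathFromTo A Set.univ p x y := by
  induction h using ReflTransGen.head_induction_on with
  | refl => exact ⟨[y], ⟨by simp, by simp, List.isChain_singleton y, by simp⟩, rfl, rfl⟩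
  | @head a c hac _ ih =>
    obtain ⟨p, ⟨hne, hnd, hc, -⟩, hhead, hlast⟩ := ih
    by_cases ha : a ∈ p
    · obtain ⟨s, t, rfl⟩ := List.append_of_mem ha
      refine ⟨a :: t, ⟨by simp, (List.nodup_append.mp hnd).2.1, ?_, by simp⟩, rfl, ?_⟩
      · exact List.IsChain.right_of_append hc
      · simpa [List.getLast?_append] using hlast
    · refine ⟨a :: p, ⟨by simp, by simp [ha, hnd], ?_, by simp⟩, rfl, ?_⟩
      · refine List.isChain_cons.mpr ⟨fun z hz => ?_, hc⟩
        rw [hhead] at hz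
        obtain rfl : c = z := by simpa using hz
        exact hac
      · cases p with
        | nil => exact absurd rfl hne
        | cons b t => simpa [List.getLast?_cons_cons] using hlast

/-- A subset of a color class is independent. -/
theorem IsSMD.not_adj_of_subset_class {A : V → V → Prop} (hA : IsSMD A) {S : Set V} {v : V}
    (hS : S ⊆ {u | SameClass A v u}) : ∀ a ∈ S, ∀ b ∈ S, ¬ A a b := by
  intro a ha b hb hab
  rcases hA.2 a v b (SameClass.symm (hS ha)) (hS hb) with rfl | h
  · exact hA.1 _ hab
  · exact h.1 hab

open Relation in
theorem StrongOn.reflTransGen {A : V → V → Prop} {S : Set V} (hS : StrongOn A S) {x y : V}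
    (hx : x ∈ S) (hy : y ∈ S) : ReflTransGen A x y := by
  by_cases hxy : x = y
  · exact hxy ▸ .refl
  · obtain ⟨p, hp⟩ := hS x hx y hy hxy
    exact hp.reflTransGen

namespace IsLinearDecompOn

variable {A : V → V → Prop} {k : ℕ} {R : Fin k → Set V}

open Relation in
theorem le_of_reflTransGen (hR : IsLinearDecompOn A Set.univ k R) {x y : V}
    (h : ReflTransGen A x y) {i j : Fin k} (hi : x ∈ R i) (hj : y ∈ R j) : i ≤ j := by
  induction h using ReflTransGen.head_induction_on generalizing i with
  | refl => exact ((hR.2.1 y trivial).unique hi hj).le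
  | @head a c hac _ ih =>
    obtain ⟨l, hl, -⟩ := hR.2.1 c trivial
    exact (not_lt.mp fun hlt => hR.2.2.2.1 l i hlt a hi c hl hac).trans (ih hl)

theorem not_unilateral_of_independent (hR : IsLinearDecompOn A Set.univ k R) {i : Fin k}
    (hcard : 2 ≤ (R i).ncard) (hind : ∀ a ∈ R i, ∀ b ∈ R i, ¬ A a b) : ¬ Unilateral A := by
  have key : ∀ x ∈ R i, ∀ y ∈ R i, x ≠ y → ¬ ∃ p, IsPathFromTo A Set.univ p x y := by
    rintro x hx y hy hxy ⟨p, hp⟩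
    rcases hp.reflTransGen.cases_head with h | ⟨z, hxz, hzy⟩
    · exact hxy h
    · obtain ⟨l, hl, -⟩ := hR.2.1 z trivial
      obtain rfl : i = l :=
        le_antisymm (hR.le_of_reflTransGen (.single hxz) hx hl) (hR.le_of_reflTransGen hzy hl hy)
      exact hind x hx z hl hxz
  obtain ⟨x, y, hx, hy, hxy⟩ :=
    (Set.one_lt_ncard_iff (Set.finite_of_ncard_ne_zero (by omega))).mp hcard
  intro hU
  exact (hU x y hxy).elim (key x hx y hy hxy) (key y hy x hx hxy.symm)

theorem ncard_eq_one_or_strongOn [Finite V] (hA : IsSMD A)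
    (hR : IsLinearDecompOn A Set.univ k R) {i : Fin k}
    (h : ¬ (2 ≤ (R i).ncard ∧ ∀ a ∈ R i, ∀ b ∈ R i, ¬ A a b)) :
    (R i).ncard = 1 ∨ StrongOn A (R i) := by
  rcases hR.2.2.1 i with hs | ⟨v, hv⟩
  · exact Or.inr hs.2.1
  · have hpos := (Set.ncard_pos (R i).toFinite).mpr (hR.1 i).1
    have hlt : ¬ 2 ≤ (R i).ncard := fun h2 => h ⟨h2, hA.not_adj_of_subset_class hv⟩
    exact Or.inl (by omega)

open Relation in
theorem reflTransGen_of_le (hR : IsLinearDecompOn A Set.univ k R)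
    (h : ∀ i, ∀ x ∈ R i, ∀ y ∈ R i, ReflTransGen A x y) {i j : Fin k} (hij : i ≤ j) {x y : V}
    (hx : x ∈ R i) (hy : y ∈ R j) : ReflTransGen A x y := by
  obtain ⟨j, hj⟩ := j
  replace hij : (i : ℕ) ≤ j := hij
  induction j, hij using Nat.le_induction generalizing y with
  | base => exact h i x hx y hy
  | succ n _ ih =>
    obtain ⟨a, ha, b, hb, hab⟩ := hR.2.2.2.2 ⟨n, by omega⟩ hj
    exact ((ih _ ha).tail hab).trans (h _ b hb y hy)

theorem unilateral (hR : IsLinearDecompOn A Set.univ k R)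
    (h : ∀ i, (R i).ncard = 1 ∨ StrongOn A (R i)) : Unilateral A := by
  have hreach : ∀ i, ∀ x ∈ R i, ∀ y ∈ R i, Relation.ReflTransGen A x y := by
    intro i x hx y hy
    rcases h i with h1 | hs
    · obtain ⟨a, ha⟩ := Set.ncard_eq_one.mp h1
      rw [ha, Set.mem_singleton_iff] at hx hy
      rw [hx, hy]
    · exact hs.reflTransGen hx hy
  intro x y _
  obtain ⟨i, hi, -⟩ := hR.2.1 x trivial
  obtain ⟨j, hj, -⟩ := hR.2.1 y trivial
  exact (le_total i j).imp
    (fun hij => exists_isPathFromTo_univ_of_reflTransGen (hR.reflTransGen_of_le hreach hij hi hj))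
    (fun hji => exists_isPathFromTo_univ_of_reflTransGen (hR.reflTransGen_of_le hreach hji hj hi))

end IsLinearDecompOn

/-- An SMD is unilaterally connected iff no element of its linear
decomposition is an independent set of size at least 2; equivalently, iff every
element of its linear decomposition is a singleton or induces a strong subdigraph. -/
theorem stmt_8 {V : Type*} [Fintype V] (A : V → V → Prop)
    (hSMD : IsSMD A) (k : ℕ) (R : Fin k → Set V)
    (hR : IsLinearDecompOn A Set.univ k R) :
    (Unilateral A ↔
      ∀ i, ¬ (2 ≤ (R i).ncard ∧ ∀ a ∈ R i, ∀ b ∈ R i, ¬ A a b)) ∧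
    (Unilateral A ↔ ∀ i, (R i).ncard = 1 ∨ StrongOn A (R i)) := by
  have hind : Unilateral A → ∀ i, ¬ (2 ≤ (R i).ncard ∧ ∀ a ∈ R i, ∀ b ∈ R i, ¬ A a b) :=
    fun hU i hi => hR.not_unilateral_of_independent hi.1 hi.2 hU
  exact ⟨⟨hind, fun h => hR.unilateral fun i => hR.ncard_eq_one_or_strongOn hSMD (h i)⟩,
    fun hU i => hR.ncard_eq_one_or_strongOn hSMD (hind hU i), hR.unilateral⟩
end

section
/- Every semicomplete multipartite digraph contains a quasi-Hamiltonian path, i.e., a path that contains at least one vertex from each color class. -/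
open Set

variable {V : Type*}

/-- In a chain starting at `a`, a vertex `v` dominated by `a` and joined by an arc to every
other vertex can be inserted after `a`. -/
theorem exists_perm_cons_isChain_of_rel {α : Type*} {R : α → α → Prop} {v : α} (l : List α) :
    ∀ a, List.IsChain R (a :: l) → (∀ u ∈ l, R u v ∨ R v u) → R a v →
      ∃ l' : List α, l'.Perm (v :: l) ∧ List.IsChain R (a :: l') := by
  induction l with
  | nil => exact fun a _ _ hav => ⟨[v], List.Perm.refl _, by simpa using hav⟩
  | cons b l ih =>
    intro a hc hl hav
    rw [List.isChain_cons_cons] at hc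
    rcases hl b (by simp) with hbv | hvb
    · obtain ⟨l', hp, hc'⟩ := ih b hc.2 (fun u hu => hl u (by simp [hu])) hbv
      exact ⟨b :: l', (hp.cons b).trans (List.Perm.swap v b l),
        List.isChain_cons_cons.2 ⟨hc.1, hc'⟩⟩
    · exact ⟨v :: b :: l, List.Perm.refl _, by simp [List.isChain_cons_cons, hav, hvb, hc.2]⟩

/-- A vertex joined by an arc to every vertex of a chain can be inserted into the chain. -/
theorem exists_perm_cons_isChain {α : Type*} {R : α → α → Prop} {v : α} {l : List α}
    (hc : List.IsChain R l) (hl : ∀ u ∈ l, R u v ∨ R v u) :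
    ∃ l' : List α, l'.Perm (v :: l) ∧ List.IsChain R l' := by
  cases l with
  | nil => exact ⟨[v], List.Perm.refl _, by simp⟩
  | cons a l =>
    rcases hl a (by simp) with hav | hva
    · obtain ⟨l', hp, hc'⟩ :=
        exists_perm_cons_isChain_of_rel l a hc (fun u hu => hl u (by simp [hu])) hav
      exact ⟨a :: l', (hp.cons a).trans (List.Perm.swap v a l), hc'⟩
    · exact ⟨v :: a :: l, List.Perm.refl _, List.isChain_cons_cons.2 ⟨hva, hc⟩⟩

/-- Any finite set of vertices has its color classes met by a single chain without repetition. -/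
theorem exists_nodup_isChain_sameClass {V : Type*} (A : V → V → Prop) (s : Finset V) :
    ∃ p : List V, p.Nodup ∧ List.IsChain A p ∧ ∀ v ∈ s, ∃ u ∈ p, SameClass A u v := by
  classical
  induction s using Finset.induction_on with
  | empty => exact ⟨[], by simp⟩
  | insert v s _ ih =>
    obtain ⟨p, hn, hc, hs⟩ := ih
    by_cases hv : ∃ u ∈ p, SameClass A u v
    · exact ⟨p, hn, hc, by simpa using ⟨hv, hs⟩⟩
    · have hjoin : ∀ u ∈ p, u ≠ v ∧ (A u v ∨ A v u) := by
        intro u hu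
        have huv : ¬ SameClass A u v := fun h => hv ⟨u, hu, h⟩
        unfold SameClass at huv
        tauto
      obtain ⟨q, hq, hqc⟩ := exists_perm_cons_isChain hc fun u hu => (hjoin u hu).2
      refine ⟨q, hq.nodup_iff.2 (List.nodup_cons.2 ⟨fun h => (hjoin v h).1 rfl, hn⟩), hqc, ?_⟩
      intro w hw
      rcases Finset.mem_insert.1 hw with rfl | hw
      · exact ⟨w, hq.mem_iff.2 (by simp), Or.inl rfl⟩
      · obtain ⟨u, hu, huw⟩ := hs w hw
        exact ⟨u, hq.mem_iff.2 (by simp [hu]), huw⟩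

/-- Every (nonempty) semicomplete multipartite digraph contains a
quasi-Hamiltonian path, i.e. a path meeting every color class. -/
theorem stmt_9 {V : Type*} [Fintype V] [Nonempty V] (A : V → V → Prop)
    (hSMD : IsSMD A) :
    ∃ p : List V, IsPathOn A Set.univ p ∧ ∀ v : V, ∃ u ∈ p, SameClass A u v := by
  obtain ⟨p, hn, hc, hp⟩ := exists_nodup_isChain_sameClass A Finset.univ
  have hne : p ≠ [] := by
    obtain ⟨u, hu, -⟩ := hp (Classical.arbitrary V) (Finset.mem_univ _)
    exact List.ne_nil_of_mem hu
  exact ⟨p, ⟨hne, hn, hc, fun v _ => Set.mem_univ v⟩, fun v => hp v (Finset.mem_univ v)⟩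
end

section
/- Let D=(V,A) be a semicomplete multipartite digraph, let P be an (s_1,t_1)-path and Q an (s_2,t_2)-path in D such that the union of P and Q (as a digraph) contains no directed cycle, and let X ⊆ V(P) ∪ V(Q) be a set of vertices lying in pairwise distinct color classes. Then D contains an (s_i,t_j)-path R for some i, j ∈ {1,2} with V(R) ⊆ V(P) ∪ V(Q) and X ⊆ V(R). -/
open Set

variable {V : Type*}

theorem isChain_pair_isInfix {l P : List V} (h : l <:+: P) :
    l.IsChain (fun a b => [a, b] <:+: P) := by
  induction l with
  | nil => exact List.isChain_nil
  | cons a l ih =>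
    cases l with
    | nil => exact List.isChain_singleton a
    | cons b l =>
      refine List.isChain_cons_cons.2 ⟨List.IsInfix.trans ⟨[], l, rfl⟩ h, ih ?_⟩
      exact List.IsInfix.trans ⟨[a], [], by simp⟩ h

/-- Two paths that traverse some pair of vertices in opposite orders contain a cycle in
their union. -/
theorem hasCycle_of_opposite {P Q : List V} (hP : P.Nodup) (hQ : Q.Nodup) (u v : V) (M : List V) :
    ∀ N P₁ P₂ Q₁ Q₂ : List V, P = P₁ ++ u :: (M ++ v :: P₂) → Q = Q₁ ++ v :: (N ++ u :: Q₂) →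
      HasCycle (fun a b => [a, b] <:+: P ∨ [a, b] <:+: Q) := by
  induction h : M.length using Nat.strong_induction_on generalizing M v with
  | _ n ih =>
    intro N P₁ P₂ Q₁ Q₂ hPe hQe
    by_cases hd : ∃ x, x ∈ M ∧ x ∈ N
    · obtain ⟨x, hxM, hxN⟩ := hd
      obtain ⟨M₁, M₂, rfl⟩ := List.append_of_mem hxM
      obtain ⟨N₁, N₂, rfl⟩ := List.append_of_mem hxN
      refine ih M₁.length (by simp at h; omega) x M₁ rfl N₂ P₁ (M₂ ++ v :: P₂)
        (Q₁ ++ v :: N₁) Q₂ (by simp [hPe]) (by simp [hQe])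
    · push Not at hd
      have hP' : (u :: (M ++ [v])) <:+: P := ⟨P₁, P₂, by simp [hPe]⟩
      have hQ' : (v :: N) <:+: Q := ⟨Q₁, u :: Q₂, by simp [hQe]⟩
      have hcP := isChain_pair_isInfix hP'
      have hcQ := isChain_pair_isInfix hQ'
      have hnP := hP'.sublist.nodup hP
      have hnQ : (v :: (N ++ [u])).Nodup :=
        List.Sublist.nodup (List.IsInfix.sublist ⟨Q₁, Q₂, by simp [hQe]⟩) hQ
      obtain ⟨L, b, hL⟩ : ∃ L b, v :: N = L ++ [b] :=
        ⟨_, _, (List.dropLast_append_getLast (List.cons_ne_nil v N)).symm⟩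
      refine ⟨u :: M ++ v :: N, by simp; omega, ?_, ?_, u, b, by simp, ?_, ?_⟩
      · simp only [List.nodup_cons, List.nodup_append, List.mem_append, List.mem_cons,
          List.cons_append] at hnP hnQ ⊢
        grind
      · exact List.isChain_split.2 ⟨hcP.imp fun _ _ => Or.inl, hcQ.imp fun _ _ => Or.inr⟩
      · rw [hL, ← List.append_assoc, List.getLast?_concat]
      · refine Or.inr ⟨Q₁ ++ L, Q₂, ?_⟩
        have : v :: (N ++ u :: Q₂) = L ++ [b] ++ u :: Q₂ := by rw [← hL]; simp
        rw [hQe, this]; simp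

/-- The paths `P` and `Q` traverse their common vertices in the same order. -/
def OrderConsistent (P Q : List V) : Prop :=
  ∀ u v, u ≠ v → [u, v].Sublist P → ¬ [v, u].Sublist Q

theorem OrderConsistent.symm {P Q : List V} (h : OrderConsistent P Q) : OrderConsistent Q P :=
  fun u v huv hQ hP => h v u huv.symm hP hQ

theorem OrderConsistent.mono {P Q P' Q' : List V} (h : OrderConsistent P Q)
    (hP : P'.Sublist P) (hQ : Q'.Sublist Q) : OrderConsistent P' Q' :=
  fun u v huv h₁ h₂ => h u v huv (h₁.trans hP) (h₂.trans hQ)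

theorem exists_eq_of_pair_sublist {u v : V} {P : List V} (h : [u, v].Sublist P) :
    ∃ P₁ M P₂, P = P₁ ++ u :: (M ++ v :: P₂) := by
  obtain ⟨r₁, r₂, rfl, hu, hv⟩ := List.cons_sublist_iff.1 h
  obtain ⟨a, b, rfl⟩ := List.append_of_mem hu
  obtain ⟨c, d, rfl⟩ := List.append_of_mem (List.singleton_sublist.1 hv)
  exact ⟨a, b ++ c, d, by simp⟩

theorem orderConsistent_of_not_hasCycle {P Q : List V} (hP : P.Nodup) (hQ : Q.Nodup)
    (h : ¬ HasCycle (fun a b => [a, b] <:+: P ∨ [a, b] <:+: Q)) : OrderConsistent P Q := by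
  intro u v _ hu hv
  obtain ⟨P₁, M, P₂, hPe⟩ := exists_eq_of_pair_sublist hu
  obtain ⟨Q₁, N, Q₂, hQe⟩ := exists_eq_of_pair_sublist hv
  exact h (hasCycle_of_opposite hP hQ u v M N P₁ P₂ Q₁ Q₂ hPe hQe)

/-- `R` is a path inside `P ∪ Q` that starts where `P` or `Q` starts, ends where `P` or `Q`
ends, and covers the vertices of `X` on `P ∪ Q`. -/
structure IsMerge (A : V → V → Prop) (X : Set V) (P Q R : List V) : Prop where
  nodup : R.Nodup
  chain : R.IsChain A
  head : R.head? = P.head? ∨ R.head? = Q.head?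
  last : R.getLast? = P.getLast? ∨ R.getLast? = Q.getLast?
  subset : ∀ v ∈ R, v ∈ P ∨ v ∈ Q
  cover : ∀ x ∈ X, x ∈ P ∨ x ∈ Q → x ∈ R

namespace IsMerge

variable {A : V → V → Prop} {X : Set V} {P Q R p q : List V} {s t : V}

theorem swap (h : IsMerge A X P Q R) : IsMerge A X Q P R :=
  ⟨h.nodup, h.chain, h.head.symm, h.last.symm, fun v hv => (h.subset v hv).symm,
    fun x hx hxm => h.cover x hx hxm.symm⟩

theorem of_right (hn : Q.Nodup) (hc : Q.IsChain A) (hX : ∀ x ∈ X, x ∈ P → x ∈ Q) :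
    IsMerge A X P Q Q :=
  ⟨hn, hc, Or.inr rfl, Or.inr rfl, fun _ hv => Or.inr hv,
    fun x hx h => h.elim (hX x hx) id⟩

theorem getLast?_cons_of_ne_nil {l : List V} (h : l ≠ []) : (s :: l).getLast? = l.getLast? := by
  cases l <;> simp_all

/-- A merge of the tails of two paths with a common start extends to that start. -/
theorem cons_cons (hP : (s :: p).Nodup) (hQ : (s :: q).Nodup) (hcP : (s :: p).IsChain A)
    (hcQ : (s :: q).IsChain A) (hp : p ≠ []) (hq : q ≠ []) (h : IsMerge A X p q R) :
    IsMerge A X (s :: p) (s :: q) (s :: R) := by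
  have hR : R ≠ [] := by
    rintro rfl
    rcases h.head with h | h <;> simp_all [eq_comm]
  refine ⟨List.nodup_cons.2 ⟨fun hs => ?_, h.nodup⟩, List.isChain_cons.2 ⟨?_, h.chain⟩,
    Or.inl rfl, ?_, ?_, ?_⟩
  · rcases h.subset s hs with hs | hs
    · exact (List.nodup_cons.1 hP).1 hs
    · exact (List.nodup_cons.1 hQ).1 hs
  · intro y hy
    rcases h.head with h | h
    · exact (List.isChain_cons.1 hcP).1 y (h ▸ hy)
    · exact (List.isChain_cons.1 hcQ).1 y (h ▸ hy)
  · rw [getLast?_cons_of_ne_nil hR, getLast?_cons_of_ne_nil hp, getLast?_cons_of_ne_nil hq]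
    exact h.last
  · intro v hv
    have := h.subset v
    grind
  · intro x hx hxm
    have := h.cover x hx
    grind

/-- If the path `s :: p` starts inside the other path, the preceding part of the latter can be
prepended to a merge. -/
theorem append (hQ : (q ++ s :: Q).Nodup) (hcQ : (q ++ s :: Q).IsChain A)
    (hd : ∀ v ∈ q, v ∉ s :: p) (h : IsMerge A X (s :: p) (s :: Q) R) :
    IsMerge A X (s :: p) (q ++ s :: Q) (q ++ R) := by
  obtain ⟨r, rfl⟩ : ∃ r, R = s :: r := by
    cases R with
    | nil => simpa using h.head
    | cons a r =>
      have := h.head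
      simp only [List.head?_cons, or_self, Option.some.injEq] at this
      exact ⟨r, by rw [this]⟩
  refine ⟨?_, ?_, Or.inr ?_, ?_, ?_, ?_⟩
  · have := h.subset
    have := h.nodup
    rw [List.nodup_append] at hQ ⊢
    grind
  · exact List.isChain_split.2 ⟨(List.isChain_split.1 hcQ).1, h.chain⟩
  · simp [List.head?_append]
  · have := h.last
    rwa [List.getLast?_append_of_ne_nil _ (List.cons_ne_nil s r),
      List.getLast?_append_of_ne_nil _ (List.cons_ne_nil s Q)]
  · intro v hv
    have := h.subset v
    grind
  · intro x hx hxm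
    have := h.cover x hx
    grind

/-- If `s` may be followed by `t` or need not be covered, a merge of `p` and `t :: q` yields a
merge of `s :: p` and `t :: q`. -/
theorem exists_cons (hP : (s :: p).Nodup) (hcP : (s :: p).IsChain A) (hp : p ≠ [])
    (hs : s ∉ t :: q) (hst : s ∈ X → A s t) (h : IsMerge A X p (t :: q) R) :
    ∃ R', IsMerge A X (s :: p) (t :: q) R' := by
  have hR : R ≠ [] := by
    rintro rfl
    rcases h.head with h | h <;> simp_all [eq_comm]
  have hsR : s ∉ R := fun hsR => (h.subset s hsR).elim (List.nodup_cons.1 hP).1 hs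
  have hlast := h.last
  rw [← getLast?_cons_of_ne_nil (s := s) hp] at hlast
  by_cases hh : R.head? = p.head? ∨ s ∈ X
  · refine ⟨s :: R, List.nodup_cons.2 ⟨hsR, h.nodup⟩, List.isChain_cons.2 ⟨fun y hy => ?_, h.chain⟩,
      Or.inl rfl, (getLast?_cons_of_ne_nil (s := s) hR).symm ▸ hlast, fun v hv => ?_,
      fun x hx hxm => ?_⟩
    · by_cases h₁ : R.head? = p.head?
      · exact (List.isChain_cons.1 hcP).1 y (h₁ ▸ hy)
      · have h₂ := h.head.resolve_left h₁
        rw [h₂] at hy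
        obtain rfl : t = y := by simpa using hy
        exact hst (hh.resolve_left h₁)
    · have := h.subset v
      grind
    · have := h.cover x hx
      grind
  · push Not at hh
    refine ⟨R, h.nodup, h.chain, Or.inr (h.head.resolve_left hh.1), hlast, fun v hv => ?_,
      fun x hx hxm => ?_⟩
    · have := h.subset v hv
      grind
    · have := h.cover x hx
      grind

end IsMerge

theorem exists_isMerge (A : V → V → Prop) (X : Set V)
    (hX : ∀ a ∈ X, ∀ b ∈ X, a ≠ b → A a b ∨ A b a) (P Q : List V) (hP₀ : P ≠ []) (hQ₀ : Q ≠ [])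
    (hP : P.Nodup) (hQ : Q.Nodup) (hcP : P.IsChain A) (hcQ : Q.IsChain A)
    (hPQ : OrderConsistent P Q) : ∃ R, IsMerge A X P Q R := by
  induction hn : P.length + Q.length using Nat.strong_induction_on generalizing P Q with
  | _ n ih =>
    have start_mem : ∀ s p t q, (s :: p).length + (t :: q).length = n →
        (s :: p).Nodup → (t :: q).Nodup → (s :: p).IsChain A → (t :: q).IsChain A →
        OrderConsistent (s :: p) (t :: q) → s ≠ t → s ∈ q →
        ∃ R, IsMerge A X (s :: p) (t :: q) R := by
      intro s p t q hn hP hQ hcP hcQ hPQ hst hs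
      obtain ⟨q₁, q₂, rfl⟩ := List.append_of_mem hs
      have hsuf : (s :: q₂) <:+ (t :: (q₁ ++ s :: q₂)) := ⟨t :: q₁, by simp⟩
      obtain ⟨R, hR⟩ := ih _ (by simp at hn ⊢; omega) (s :: p) (s :: q₂) (by simp) (by simp) hP
        (hsuf.sublist.nodup hQ) hcP (hcQ.suffix hsuf)
        (hPQ.mono (List.Sublist.refl _) hsuf.sublist) rfl
      refine ⟨t :: q₁ ++ R, IsMerge.append (q := t :: q₁) hQ hcQ (fun v hv hvp => ?_) hR⟩
      have hvs : s ≠ v := by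
        rintro rfl
        exact (List.nodup_append.1 (show (t :: q₁ ++ s :: q₂).Nodup from hQ)).2.2 s hv s
          (by simp) rfl
      refine hPQ s v hvs ?_ ?_
      · exact (List.singleton_sublist.2 ((List.mem_cons.1 hvp).resolve_left hvs.symm)).cons_cons s
      · exact (List.singleton_sublist.2 hv).append
          (List.singleton_sublist.2 (List.mem_cons_self (a := s) (l := q₂)))
    have start_arc : ∀ s p t q, (s :: p).length + (t :: q).length = n →
        (s :: p).Nodup → (t :: q).Nodup → (s :: p).IsChain A → (t :: q).IsChain A →
        OrderConsistent (s :: p) (t :: q) → s ∉ t :: q → (s ∈ X → A s t) →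
        ∃ R, IsMerge A X (s :: p) (t :: q) R := by
      intro s p t q hn hP hQ hcP hcQ hPQ hs hst
      by_cases hp : p = []
      · subst hp
        by_cases hsX : s ∈ X
        · refine ⟨s :: t :: q, List.nodup_cons.2 ⟨hs, hQ⟩,
            List.isChain_cons_cons.2 ⟨hst hsX, hcQ⟩, Or.inl rfl, Or.inr (by simp),
            fun v hv => ?_, fun x hx hxm => ?_⟩ <;> grind
        · exact ⟨_, IsMerge.of_right hQ hcQ (by grind)⟩
      · obtain ⟨R, hR⟩ := ih _ (by simp at hn ⊢; omega) p (t :: q) hp (by simp) hP.of_cons hQ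
          hcP.tail hcQ (hPQ.mono (List.sublist_cons_self _ _) (List.Sublist.refl _)) rfl
        exact IsMerge.exists_cons hP hcP hp hs hst hR
    obtain ⟨s, p, rfl⟩ := List.exists_cons_of_ne_nil hP₀
    obtain ⟨t, q, rfl⟩ := List.exists_cons_of_ne_nil hQ₀
    have hn' : (t :: q).length + (s :: p).length = n := by rw [← hn, add_comm]
    by_cases hst : s = t
    · subst hst
      by_cases hp : p = []
      · exact ⟨_, IsMerge.of_right hQ hcQ (by simp +contextual [hp])⟩
      by_cases hq : q = []
      · exact ⟨_, (IsMerge.of_right hP hcP (by simp +contextual [hq])).swap⟩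
      obtain ⟨R, hR⟩ := ih _ (by simp at hn ⊢; omega) p q hp hq hP.of_cons hQ.of_cons
        hcP.tail hcQ.tail (hPQ.mono (List.sublist_cons_self _ _) (List.sublist_cons_self _ _)) rfl
      exact ⟨_, hR.cons_cons hP hQ hcP hcQ hp hq⟩
    by_cases hs : s ∈ q
    · exact start_mem s p t q hn hP hQ hcP hcQ hPQ hst hs
    by_cases ht : t ∈ p
    · exact (start_mem t q s p hn' hQ hP hcQ hcP hPQ.symm (Ne.symm hst) ht).imp
        fun _ h => h.swap
    by_cases harc : s ∈ X → A s t
    · exact start_arc s p t q hn hP hQ hcP hcQ hPQ (by simp [hst, hs]) harc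
    · refine (start_arc t q s p hn' hQ hP hcQ hcP hPQ.symm (by simp [Ne.symm hst, ht]) ?_).imp
        fun _ h => h.swap
      have := hX s
      grind

/-- **merging lemma.** Let `P` be an `(s₁,t₁)`-path and `Q` an
`(s₂,t₂)`-path in an SMD such that the union digraph of `P` and `Q` has no directed
cycle, and let `X ⊆ V(P) ∪ V(Q)` consist of vertices from pairwise distinct color
classes. Then there is an `(sᵢ,tⱼ)`-path `R` (for some `i, j ∈ {1,2}`) with
`V(R) ⊆ V(P) ∪ V(Q)` covering `X`. -/
theorem stmt_11 {V : Type*} [Fintype V] (A : V → V → Prop) (hSMD : IsSMD A)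
    (s₁ t₁ s₂ t₂ : V) (P Q : List V)
    (hP : IsPathFromTo A Set.univ P s₁ t₁) (hQ : IsPathFromTo A Set.univ Q s₂ t₂)
    (hacyc : ¬ HasCycle (fun a b => [a, b] <:+: P ∨ [a, b] <:+: Q))
    (X : Set V) (hXsub : ∀ x ∈ X, x ∈ P ∨ x ∈ Q)
    (hXdist : ∀ a ∈ X, ∀ b ∈ X, SameClass A a b → a = b) :
    ∃ (s t : V) (R : List V), (s = s₁ ∨ s = s₂) ∧ (t = t₁ ∨ t = t₂) ∧
      IsPathFromTo A Set.univ R s t ∧ (∀ v ∈ R, v ∈ P ∨ v ∈ Q) ∧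
      ∀ x ∈ X, x ∈ R := by
  obtain ⟨⟨hP₀, hPn, hPc, -⟩, hPs, hPt⟩ := hP
  obtain ⟨⟨hQ₀, hQn, hQc, -⟩, hQs, hQt⟩ := hQ
  have hX : ∀ a ∈ X, ∀ b ∈ X, a ≠ b → A a b ∨ A b a := by
    intro a ha b hb hab
    by_contra h
    exact hab (hXdist a ha b hb (Or.inr (not_or.1 h)))
  obtain ⟨R, hR⟩ := exists_isMerge A X hX P Q hP₀ hQ₀ hPn hQn hPc hQc
    (orderConsistent_of_not_hasCycle hPn hQn hacyc)
  have hhead := hR.head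
  have hlast := hR.last
  rw [hPs, hQs] at hhead
  rw [hPt, hQt] at hlast
  have hR₀ : R ≠ [] := by
    rintro rfl
    simp at hhead
  have hpath : IsPathOn A Set.univ R := ⟨hR₀, hR.nodup, hR.chain, fun _ _ => trivial⟩
  have hcover : ∀ x ∈ X, x ∈ R := fun x hx => hR.cover x hx (hXsub x hx)
  rcases hhead with hs | hs <;> rcases hlast with ht | ht <;>
    exact ⟨_, _, R, by simp, by simp, ⟨hpath, hs, ht⟩, hR.subset, hcover⟩
end
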